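/- Suppose all k groups are interior (n_j ≥ 2 and 1 ≤ y_j ≤ n_j − 1 for all j), let u > 0, and suppose k ≥ u + 1 and rank(X) = m, where X is the k×m covariate matrix with rows x_1ᵀ,…,x_kᵀ. Then ∫_{ℝ^m} ∫_0^∞ r^{−(u+1)} · L(r, β) dr dβ < ∞. -/

import Mathlib

open MeasureTheory Real Filter Finset

/-- The Beta function `B(a,b) = ∫₀¹ v^(a-1) (1-v)^(b-1) dv`. -/
noncomputable def betaFn (a b : ℝ) : ℝ :=
  ∫ v in (0:ℝ)..1, v ^ (a - 1) * (1 - v) ^ (b - 1)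

/-- The standard logistic function `σ(t) = exp t / (1 + exp t)`. -/
noncomputable def logistic (t : ℝ) : ℝ := Real.exp t / (1 + Real.exp t)

/-- Expected random effect `p_j^E(β) = σ(x_jᵀ β)`. -/
noncomputable def pE {k m : ℕ} (x : Fin k → Fin m → ℝ) (j : Fin k) (β : Fin m → ℝ) : ℝ :=
  logistic (∑ i, x j i * β i)

/-- The Beta-Binomial likelihood
`L(r,β) = ∏ⱼ C(nⱼ,yⱼ) B(yⱼ + r pⱼᴱ, nⱼ - yⱼ + r qⱼᴱ) / B(r pⱼᴱ, r qⱼᴱ)`. -/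
noncomputable def bbL {k m : ℕ} (x : Fin k → Fin m → ℝ) (n y : Fin k → ℕ)
    (r : ℝ) (β : Fin m → ℝ) : ℝ :=
  ∏ j : Fin k,
    ((n j).choose (y j) : ℝ) *
      betaFn ((y j : ℝ) + r * pE x j β) (((n j : ℝ) - (y j : ℝ)) + r * (1 - pE x j β)) /
      betaFn (r * pE x j β) (r * (1 - pE x j β))

lemma betaFn_integrand_eq {a b v : ℝ} (hv : v ∈ Set.Icc (0:ℝ) 1) :
    ((v : ℂ) ^ ((a : ℂ) - 1) * (1 - (v : ℂ)) ^ ((b : ℂ) - 1)) =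
      ((v ^ (a - 1) * (1 - v) ^ (b - 1) : ℝ) : ℂ) := by
  rw [Complex.ofReal_mul, Complex.ofReal_cpow hv.1, Complex.ofReal_cpow (sub_nonneg.2 hv.2)]
  push_cast
  rfl

lemma intervalIntegrable_betaFn {a b : ℝ} (ha : 0 < a) (hb : 0 < b) :
    IntervalIntegrable (fun v : ℝ ↦ v ^ (a - 1) * (1 - v) ^ (b - 1)) volume 0 1 := by
  have h := Complex.betaIntegral_convergent (u := a) (v := b) (by simpa) (by simpa)
  rw [intervalIntegrable_iff_integrableOn_Ioc_of_le zero_le_one] at h ⊢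
  refine (IntegrableOn.congr_fun h.re (fun v hv ↦ ?_) measurableSet_Ioc)
  simp only [betaFn_integrand_eq (a := a) (b := b) (Set.Ioc_subset_Icc_self hv)]
  exact Complex.ofReal_re _

lemma betaFn_eq_Gamma {a b : ℝ} (ha : 0 < a) (hb : 0 < b) :
    betaFn a b = Gamma a * Gamma b / Gamma (a + b) := by
  change _ = ProbabilityTheory.beta a b
  rw [ProbabilityTheory.beta_eq_betaIntegralReal a b ha hb, Complex.betaIntegral, betaFn,
    intervalIntegral.integral_congr (g := fun v : ℝ ↦
      ((v ^ (a - 1) * (1 - v) ^ (b - 1) : ℝ) : ℂ)) (μ := volume)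
      (fun v hv ↦ betaFn_integrand_eq (by rwa [Set.uIcc_of_le zero_le_one] at hv)),
    intervalIntegral.integral_ofReal, Complex.ofReal_re]

lemma betaFn_pos {a b : ℝ} (ha : 0 < a) (hb : 0 < b) : 0 < betaFn a b := by
  rw [betaFn_eq_Gamma ha hb]
  exact div_pos (mul_pos (Gamma_pos_of_pos ha) (Gamma_pos_of_pos hb))
    (Gamma_pos_of_pos (add_pos ha hb))

lemma betaFn_anti {a b a' b' : ℝ} (ha : 0 < a) (hb : 0 < b) (haa : a ≤ a') (hbb : b ≤ b') :
    betaFn a' b' ≤ betaFn a b := by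
  refine intervalIntegral.integral_mono_on_of_le_Ioo zero_le_one
    (intervalIntegrable_betaFn (ha.trans_le haa) (hb.trans_le hbb))
    (intervalIntegrable_betaFn ha hb) fun v hv ↦ ?_
  have h0 : 0 < 1 - v := sub_pos.2 hv.2
  exact mul_le_mul (rpow_le_rpow_of_exponent_ge hv.1 hv.2.le (by linarith))
    (rpow_le_rpow_of_exponent_ge h0 (by linarith [hv.1]) (by linarith))
    (rpow_nonneg h0.le _) (rpow_nonneg hv.1.le _)

lemma betaFn_one_add_one_add {a b : ℝ} (ha : 0 < a) (hb : 0 < b) :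
    betaFn (1 + a) (1 + b) = a * b / ((a + b) * (a + b + 1)) * betaFn a b := by
  have hab : 0 < a + b := add_pos ha hb
  rw [betaFn_eq_Gamma ha hb, betaFn_eq_Gamma (by linarith) (by linarith), add_comm 1 a,
    add_comm 1 b, Gamma_add_one ha.ne', Gamma_add_one hb.ne',
    show a + 1 + (b + 1) = a + b + 1 + 1 by ring, Gamma_add_one (by positivity),
    Gamma_add_one hab.ne']
  have := (Gamma_pos_of_pos hab).ne'
  field_simp

/-- Monotonicity of the Beta function reduces an interior group to `y = n - y = 1`. -/
lemma betaFn_ratio_le {r p s t : ℝ} (hr : 0 < r) (hp : 0 < p) (hp1 : p < 1) (hs : 1 ≤ s)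
    (ht : 1 ≤ t) :
    betaFn (s + r * p) (t + r * (1 - p)) / betaFn (r * p) (r * (1 - p)) ≤
      r / (1 + r) * (p * (1 - p)) := by
  have hrp : 0 < r * p := mul_pos hr hp
  have hrq : 0 < r * (1 - p) := mul_pos hr (sub_pos.2 hp1)
  rw [div_le_iff₀ (betaFn_pos hrp hrq)]
  refine (betaFn_anti (a := 1 + r * p) (b := 1 + r * (1 - p)) (by linarith) (by linarith)
    (by linarith) (by linarith)).trans_eq ?_
  rw [betaFn_one_add_one_add hrp hrq]
  congr 1
  rw [show r * p + r * (1 - p) = r by ring]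
  field_simp
  ring

lemma logistic_pos (t : ℝ) : 0 < logistic t := by unfold logistic; positivity

lemma logistic_lt_one (t : ℝ) : logistic t < 1 := by
  rw [logistic, div_lt_one (by positivity)]
  linarith

lemma logistic_mul_one_sub_le (t : ℝ) : logistic t * (1 - logistic t) ≤ exp (-|t|) := by
  have h : logistic t * (1 - logistic t) = exp t / (1 + exp t) ^ 2 := by
    unfold logistic
    field_simp
    ring
  have ht := exp_pos t
  rw [h, div_le_iff₀ (by positivity)]
  rcases abs_cases t with ⟨h, -⟩ | ⟨h, -⟩
  · have hm : exp (-t) * exp t = 1 := by rw [← exp_add]; simp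
    have hn := exp_pos (-t)
    rw [h]
    nlinarith [mul_pos hn ht]
  · rw [h, neg_neg]
    nlinarith [mul_pos ht ht, mul_pos ht (mul_pos ht ht)]

lemma bbL_le {k m : ℕ} (x : Fin k → Fin m → ℝ) (n y : Fin k → ℕ)
    (hint : ∀ j, 2 ≤ n j ∧ 1 ≤ y j ∧ y j ≤ n j - 1) {r : ℝ} (hr : 0 < r) (β : Fin m → ℝ) :
    bbL x n y r β ≤ (∏ j, ((n j).choose (y j) : ℝ)) * (r / (1 + r)) ^ k *
      exp (-∑ j, |∑ i, x j i * β i|) := by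
  have hprod : (∏ j, ((n j).choose (y j) : ℝ)) * (r / (1 + r)) ^ k *
      exp (-∑ j, |∑ i, x j i * β i|) =
      ∏ j, (((n j).choose (y j) : ℝ) * (r / (1 + r)) * exp (-|∑ i, x j i * β i|)) := by
    rw [prod_mul_distrib, prod_mul_distrib, ← exp_sum, sum_neg_distrib,
      prod_const, card_univ, Fintype.card_fin]
  rw [hprod, bbL]
  have hcast : ∀ j, (1 : ℝ) ≤ y j ∧ (1 : ℝ) ≤ (n j : ℝ) - y j := fun j ↦ by
    obtain ⟨h2, h1, hy⟩ := hint j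
    have h : y j + 1 ≤ n j := by omega
    have h' : (y j : ℝ) + 1 ≤ n j := by exact_mod_cast h
    exact ⟨by exact_mod_cast h1, by linarith⟩
  refine prod_le_prod (fun j _ ↦ ?_) fun j _ ↦ ?_ <;>
  obtain ⟨hy, hny⟩ := hcast j <;>
  have hp : 0 < pE x j β := logistic_pos _ <;>
  have hp1 : pE x j β < 1 := logistic_lt_one _
  · have hrp : 0 < r * pE x j β := mul_pos hr hp
    have hrq : 0 < r * (1 - pE x j β) := mul_pos hr (sub_pos.2 hp1)
    exact div_nonneg (mul_nonneg (Nat.cast_nonneg _)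
      (betaFn_pos (by linarith) (by linarith)).le) (betaFn_pos hrp hrq).le
  · rw [mul_div_assoc, mul_assoc]
    refine mul_le_mul_of_nonneg_left ?_ (Nat.cast_nonneg _)
    refine (betaFn_ratio_le hr hp hp1 hy hny).trans ?_
    exact mul_le_mul_of_nonneg_left (logistic_mul_one_sub_le _) (by positivity)

lemma lintegral_exp_neg_mul_norm_lt_top {E : Type*} [NormedAddCommGroup E] [NormedSpace ℝ E]
    [FiniteDimensional ℝ E] [MeasurableSpace E] [BorelSpace E] (μ : Measure E)
    [μ.IsAddHaarMeasure] {c : ℝ} (hc : 0 < c) :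
    ∫⁻ v, ENNReal.ofReal (exp (-(c * ‖v‖))) ∂μ < ⊤ := by
  set d := Module.finrank ℝ E + 1 with hd
  have hbound : ∀ v : E, ENNReal.ofReal (exp (-(c * ‖v‖))) ≤
      ENNReal.ofReal (exp c * d.factorial / c ^ d) *
        ENNReal.ofReal ((1 + ‖v‖) ^ (-(d : ℝ))) := fun v ↦ by
    rw [← ENNReal.ofReal_mul (by positivity)]
    refine ENNReal.ofReal_le_ofReal ?_
    have hv : 0 < 1 + ‖v‖ := by positivity
    have h := pow_div_factorial_le_exp (c * (1 + ‖v‖)) (by positivity) d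
    have he : exp (-(c * ‖v‖)) = exp c * (exp (c * (1 + ‖v‖)))⁻¹ := by
      rw [← exp_neg, ← exp_add]
      ring_nf
    rw [he, rpow_neg hv.le, rpow_natCast]
    calc exp c * (exp (c * (1 + ‖v‖)))⁻¹
        ≤ exp c * ((c * (1 + ‖v‖)) ^ d / d.factorial)⁻¹ := by gcongr
      _ = _ := by
        rw [mul_pow]
        field_simp
  refine (lintegral_mono hbound).trans_lt ?_
  rw [lintegral_const_mul' _ _ ENNReal.ofReal_ne_top]
  exact ENNReal.mul_lt_top ENNReal.ofReal_lt_top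
    (finite_integral_one_add_norm (by rw [hd]; push_cast; linarith))

lemma lintegral_exp_neg_sum_abs_lt_top {k m : ℕ} (x : Fin k → Fin m → ℝ)
    (hrank : (Matrix.of x).rank = m) :
    ∫⁻ β : Fin m → ℝ, ENNReal.ofReal (exp (-∑ j, |∑ i, x j i * β i|)) < ⊤ := by
  have hker : LinearMap.ker (Matrix.of x).mulVecLin = ⊥ := by
    have h := (Matrix.of x).mulVecLin.finrank_range_add_finrank_ker
    rw [Module.finrank_fin_fun] at h
    have hr : Module.finrank ℝ (LinearMap.range (Matrix.of x).mulVecLin) = m := hrank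
    exact Submodule.finrank_eq_zero.1 (by omega)
  obtain ⟨K, hK, hanti⟩ := (Matrix.of x).mulVecLin.exists_antilipschitzWith hker
  have hK' : (0 : ℝ) < K := hK
  refine (lintegral_mono fun β ↦ ENNReal.ofReal_le_ofReal (exp_le_exp.2 (neg_le_neg ?_))).trans_lt
    (lintegral_exp_neg_mul_norm_lt_top volume (inv_pos.2 hK'))
  rw [inv_mul_le_iff₀ hK']
  refine (hanti.le_mul_norm (map_zero _) β).trans (mul_le_mul_of_nonneg_left ?_ hK'.le)
  refine (pi_norm_le_iff_of_nonneg (by positivity)).2 fun j ↦ ?_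
  exact single_le_sum (f := fun j ↦ |∑ i, x j i * β i|) (fun _ _ ↦ abs_nonneg _) (mem_univ j)

lemma lintegral_rpow_mul_div_pow_lt_top {k : ℕ} {u : ℝ} (hu : 0 < u) (hk : u + 1 ≤ k) :
    ∫⁻ r in Set.Ioi (0:ℝ), ENNReal.ofReal (r ^ (-(u + 1)) * (r / (1 + r)) ^ k) < ⊤ := by
  rw [← Set.Ioc_union_Ioi_eq_Ioi zero_le_one]
  refine (lintegral_union_le _ _ _).trans_lt (ENNReal.add_lt_top.2 ⟨?_, ?_⟩)
  · refine (setLIntegral_mono' (g := fun _ ↦ 1) measurableSet_Ioc fun r hr ↦ ?_).trans_lt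
      (by simp)
    refine ENNReal.ofReal_le_one.2 ?_
    calc r ^ (-(u + 1)) * (r / (1 + r)) ^ k ≤ r ^ (-(u + 1)) * r ^ k := by
          have := hr.1
          gcongr
          exact div_le_self hr.1.le (by linarith)
      _ = r ^ (-(u + 1) + k) := by rw [rpow_add hr.1, rpow_natCast]
      _ ≤ 1 := rpow_le_one hr.1.le hr.2 (by linarith)
  · refine (setLIntegral_mono' measurableSet_Ioi fun r (hr : 1 < r) ↦
      ENNReal.ofReal_le_ofReal ?_).trans_lt
      (integrableOn_Ioi_rpow_of_lt (a := -(u + 1)) (by linarith) one_pos).setLIntegral_lt_top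
    have hr0 : 0 < r := by linarith
    refine mul_le_of_le_one_right (by positivity) (pow_le_one₀ (by positivity) ?_)
    rw [div_le_one (by positivity)]
    linarith

/-- Theorem 3 (sufficiency): all groups interior, fully improper hyper-prior `dβ dr/r^{u+1}`,
with `k ≥ u + 1` and `rank(X) = m`. Then the posterior is proper. -/
theorem posterior_proper_fully_improper (k m : ℕ) (x : Fin k → Fin m → ℝ)
    (n y : Fin k → ℕ) (hint : ∀ j, 2 ≤ n j ∧ 1 ≤ y j ∧ y j ≤ n j - 1)
    (u : ℝ) (hu : 0 < u) (hk : u + 1 ≤ (k : ℝ)) (hrank : (Matrix.of x).rank = m) :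
    (∫⁻ β : Fin m → ℝ, ∫⁻ r in Set.Ioi (0:ℝ),
        ENNReal.ofReal (r ^ (-(u + 1)) * bbL x n y r β)) < ⊤ := by
  set C : ℝ := ∏ j, ((n j).choose (y j) : ℝ) with hC
  have hC0 : 0 ≤ C := prod_nonneg fun _ _ ↦ Nat.cast_nonneg _
  set R := ∫⁻ r in Set.Ioi (0:ℝ), ENNReal.ofReal (r ^ (-(u + 1)) * (r / (1 + r)) ^ k)
  have hR : R < ⊤ := lintegral_rpow_mul_div_pow_lt_top hu hk
  have hinner : ∀ β : Fin m → ℝ, ∫⁻ r in Set.Ioi (0:ℝ),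
      ENNReal.ofReal (r ^ (-(u + 1)) * bbL x n y r β) ≤
      ENNReal.ofReal C * R * ENNReal.ofReal (exp (-∑ j, |∑ i, x j i * β i|)) := fun β ↦ by
    rw [← lintegral_const_mul' _ _ ENNReal.ofReal_ne_top,
      ← lintegral_mul_const' _ _ ENNReal.ofReal_ne_top]
    refine setLIntegral_mono' measurableSet_Ioi fun r (hr : 0 < r) ↦ ?_
    rw [← ENNReal.ofReal_mul hC0, ← ENNReal.ofReal_mul (by positivity)]
    refine ENNReal.ofReal_le_ofReal ?_
    refine (mul_le_mul_of_nonneg_left (bbL_le x n y hint hr β) (by positivity)).trans_eq ?_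
    ring
  refine (lintegral_mono hinner).trans_lt ?_
  rw [lintegral_const_mul' _ _ (ENNReal.mul_lt_top ENNReal.ofReal_lt_top hR).ne]
  exact ENNReal.mul_lt_top (ENNReal.mul_lt_top ENNReal.ofReal_lt_top hR)
    (lintegral_exp_neg_sum_abs_lt_top x hrank)
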